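/- Let X and Y be compact metric spaces, let σ : X → X and F : Y → Y be continuous maps, and let π : X → Y be a homeomorphism with F ∘ π = π ∘ σ. Suppose there are constants c > 0 and K > 0 such that for all Borel probability measures μ, ν on X one has d_W(π_*μ, π_*ν) ≥ c · ( d_W(μ, ν) )^K. Then for every x ∈ X and every ε > 0, the pointwise emergences satisfy ℰ_{σ,x}(ε) ≤ ℰ_{F,π(x)}(c · ε^K). -/

import Mathlib

open MeasureTheory Filter Set

/-- The first Wasserstein distance between two Borel probability measures on a metric
space: the infimum of `∫ d(x,y) dP` over all couplings `P` of the two measures. -/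
noncomputable def wassersteinDist {M : Type*} [MetricSpace M] [MeasurableSpace M]
    (μ ν : Measure M) : ℝ :=
  sInf { r : ℝ | ∃ P : Measure (M × M), IsProbabilityMeasure P ∧
    P.map Prod.fst = μ ∧ P.map Prod.snd = ν ∧ r = ∫ p, dist p.1 p.2 ∂P }

/-- The `n`-th empirical measure `δ_x^n = (1/n) ∑_{k<n} δ_{f^k x}` of the point `x`. -/
noncomputable def empiricalMeasure {M : Type*} [MetricSpace M] [MeasurableSpace M]
    (f : M → M) (x : M) (n : ℕ) : Measure M :=
  (n : ENNReal)⁻¹ • ∑ k ∈ Finset.range n, Measure.dirac (f^[k] x)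

/-- The pointwise emergence `ℰ_{f,x}(ε)`: the least `N ≥ 1` such that there are Borel
probability measures `μ_1, …, μ_N` with
`limsup_{n→∞} min_{1≤j≤N} d_W(δ_x^n, μ_j) ≤ ε`. -/
noncomputable def pointwiseEmergence {M : Type*} [MetricSpace M] [MeasurableSpace M]
    (f : M → M) (x : M) (ε : ℝ) : ℕ :=
  sInf { N : ℕ | 0 < N ∧ ∃ μs : Fin N → Measure M, (∀ j, IsProbabilityMeasure (μs j)) ∧
    Filter.limsup (fun n : ℕ => ⨅ j, wassersteinDist (empiricalMeasure f x n) (μs j))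
      Filter.atTop ≤ ε }

section Wasserstein

variable {M : Type*} [MetricSpace M] [MeasurableSpace M]

lemma wassersteinDist_nonneg (μ ν : Measure M) : 0 ≤ wassersteinDist μ ν := by
  refine Real.sInf_nonneg ?_
  rintro r ⟨P, -, -, -, rfl⟩
  exact integral_nonneg fun _ => dist_nonneg

lemma wassersteinDist_le_integral {μ ν : Measure M} (P : Measure (M × M))
    [hP : IsProbabilityMeasure P] (hfst : P.map Prod.fst = μ) (hsnd : P.map Prod.snd = ν) :
    wassersteinDist μ ν ≤ ∫ p, dist p.1 p.2 ∂P := by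
  refine csInf_le ⟨0, ?_⟩ ⟨P, hP, hfst, hsnd, rfl⟩
  rintro r ⟨Q, -, -, -, rfl⟩
  exact integral_nonneg fun _ => dist_nonneg

/-- On a bounded space the Wasserstein distance is bounded by the diameter. -/
lemma wassersteinDist_le_diam [BoundedSpace M] (μ ν : Measure M) [IsProbabilityMeasure μ]
    [IsProbabilityMeasure ν] : wassersteinDist μ ν ≤ Metric.diam (univ : Set M) := by
  refine (wassersteinDist_le_integral (μ.prod ν) (by simp) (by simp)).trans ?_
  have h := integral_mono_of_nonneg (μ := μ.prod ν) (f := fun p : M × M => dist p.1 p.2)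
    (g := fun _ => Metric.diam (univ : Set M)) (ae_of_all _ fun _ => dist_nonneg)
    (integrable_const _) (ae_of_all _ fun p =>
      Metric.dist_le_diam_of_mem (Bornology.IsBounded.all _) (mem_univ _) (mem_univ _))
  simpa using h

lemma isProbabilityMeasure_empiricalMeasure (f : M → M) (x : M) {n : ℕ} (hn : n ≠ 0) :
    IsProbabilityMeasure (empiricalMeasure f x n) := by
  refine ⟨?_⟩
  simp [empiricalMeasure, ENNReal.inv_mul_cancel, hn]

lemma empiricalMeasure_map {N : Type*} [MetricSpace N] [MeasurableSpace N] {f : M → M}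
    {g : N → N} {π : M → N} (hπ : Measurable π) (h : Function.Semiconj π f g) (x : M) (n : ℕ) :
    (empiricalMeasure f x n).map π = empiricalMeasure g (π x) n := by
  ext B hB
  simp [empiricalMeasure, Measure.map_apply hπ hB, Measure.dirac_apply' _ hB,
    Measure.dirac_apply' _ (hπ hB), ← (h.iterate_right _).eq, indicator]
  rfl

/-- A compact metric space carries finitely valued measurable maps uniformly close to the
identity. -/
lemma exists_simpleFunc_dist_le [CompactSpace M] [OpensMeasurableSpace M] [Nonempty M]
    {η : ℝ} (hη : 0 < η) : ∃ s : SimpleFunc M M, ∀ y, dist y (s y) ≤ η := by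
  let e := TopologicalSpace.denseSeq M
  obtain ⟨t, ht⟩ := isCompact_univ.elim_finite_subcover (fun k => Metric.ball (e k) η)
    (fun _ => Metric.isOpen_ball) (fun y _ => by
      obtain ⟨k, hk⟩ := (TopologicalSpace.denseRange_denseSeq M).exists_dist_lt y hη
      exact mem_iUnion.2 ⟨k, hk⟩)
  refine ⟨SimpleFunc.nearestPt e (t.sup id), fun y => ?_⟩
  obtain ⟨k, hkt, hk⟩ := mem_iUnion₂.1 (ht (mem_univ y))
  have h := SimpleFunc.edist_nearestPt_le e y (Finset.le_sup (f := id) hkt)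
  rw [edist_dist, edist_dist, ENNReal.ofReal_le_ofReal_iff dist_nonneg] at h
  rw [dist_comm]
  rw [Metric.mem_ball, dist_comm] at hk
  exact h.trans hk.le

/-- Moving a fraction `t (s y)` of the mass at `y` to `s y` and the rest to `p₀`. -/
lemma wassersteinDist_rounding_le [CompactSpace M] [BorelSpace M] (μ : Measure M)
    [IsProbabilityMeasure μ] (s : SimpleFunc M M) {η : ℝ} (hη : 0 ≤ η)
    (hs : ∀ y, dist y (s y) ≤ η) (p₀ : M) (t : M → ENNReal) (ht : ∀ p, t p ≤ 1)
    (a : M → ENNReal) (ha : ∀ p, t p * μ (s ⁻¹' {p}) = a p) {κ : ℝ} (hκ : 0 ≤ κ)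
    (hrest : 1 - ∑ p ∈ s.range, a p ≤ ENNReal.ofReal κ) :
    IsProbabilityMeasure (∑ p ∈ s.range, a p • Measure.dirac p +
      (1 - ∑ p ∈ s.range, a p) • Measure.dirac p₀) ∧
    wassersteinDist μ (∑ p ∈ s.range, a p • Measure.dirac p +
      (1 - ∑ p ∈ s.range, a p) • Measure.dirac p₀) ≤
        η + Metric.diam (univ : Set M) * κ := by
  set D := Metric.diam (univ : Set M)
  have hD : 0 ≤ D := Metric.diam_nonneg
  have hlint : ∀ g : M → ENNReal, ∫⁻ y, g (s y) ∂μ = ∑ p ∈ s.range, g p * μ (s ⁻¹' {p}) := by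
    intro g
    rw [← SimpleFunc.map_lintegral, ← SimpleFunc.lintegral_eq_lintegral]
    rfl
  have hmeas : ∀ g : M → ENNReal, Measurable fun y => g (s y) := fun g =>
    (s.map g).measurable
  have hsum : ∫⁻ y, t (s y) ∂μ = ∑ p ∈ s.range, a p := by
    rw [hlint]; exact Finset.sum_congr rfl fun p _ => ha p
  have hle1 : ∫⁻ y, t (s y) ∂μ ≤ 1 := by
    calc ∫⁻ y, t (s y) ∂μ ≤ ∫⁻ _, 1 ∂μ := lintegral_mono fun y => ht _
      _ = 1 := by simp
  have hcompl : ∫⁻ y, (1 - t (s y)) ∂μ = 1 - ∑ p ∈ s.range, a p := by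
    rw [lintegral_sub (hmeas t) (ne_top_of_le_ne_top ENNReal.one_ne_top hle1)
      (ae_of_all _ fun y => ht _), hsum]
    simp
  have hf : Measurable fun y : M => (y, s y) := measurable_id.prodMk s.measurable
  have hg : Measurable fun y : M => (y, p₀) := measurable_id.prodMk measurable_const
  let P : Measure (M × M) := (μ.withDensity fun y => t (s y)).map (fun y => (y, s y)) +
    (μ.withDensity fun y => 1 - t (s y)).map (fun y => (y, p₀))
  have hfst : P.map Prod.fst = μ := by
    rw [Measure.map_add _ _ measurable_fst, Measure.map_map measurable_fst hf,
      Measure.map_map measurable_fst hg]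
    change Measure.map id _ + Measure.map id _ = μ
    rw [Measure.map_id, Measure.map_id, ← withDensity_add_left (hmeas t)]
    convert withDensity_one (μ := μ) using 2
    ext y
    simp [add_tsub_cancel_of_le (ht (s y))]
  have hsnd : P.map Prod.snd = ∑ p ∈ s.range, a p • Measure.dirac p +
      (1 - ∑ p ∈ s.range, a p) • Measure.dirac p₀ := by
    rw [Measure.map_add _ _ measurable_snd, Measure.map_map measurable_snd hf,
      Measure.map_map measurable_snd hg]
    change Measure.map s _ + Measure.map (fun _ => p₀) _ = _
    congr 1
    · ext B hB
      rw [Measure.map_apply s.measurable hB, withDensity_apply _ (s.measurable hB),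
        ← lintegral_indicator (s.measurable hB)]
      change ∫⁻ y, B.indicator t (s y) ∂μ = _
      rw [hlint]
      simp only [Measure.coe_finsetSum, Finset.sum_apply, Measure.smul_apply, smul_eq_mul,
        Measure.dirac_apply' _ hB]
      refine Finset.sum_congr rfl fun p _ => ?_
      by_cases hp : p ∈ B <;> simp [hp, ha]
    · rw [Measure.map_const, withDensity_apply _ MeasurableSet.univ, Measure.restrict_univ, hcompl]
  have hP : IsProbabilityMeasure P := by
    refine ⟨?_⟩
    rw [← preimage_univ (f := Prod.fst), ← Measure.map_apply measurable_fst MeasurableSet.univ,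
      hfst, measure_univ]
  refine ⟨hsnd ▸ Measure.isProbabilityMeasure_map measurable_snd.aemeasurable,
    (wassersteinDist_le_integral P hfst hsnd).trans ?_⟩
  have hdist : Measurable fun p : M × M => ENNReal.ofReal (dist p.1 p.2) :=
    (measurable_fst.dist measurable_snd).ennreal_ofReal
  rw [integral_eq_lintegral_of_nonneg_ae (ae_of_all _ fun _ => dist_nonneg)
    (measurable_fst.dist measurable_snd).aestronglyMeasurable]
  refine ENNReal.toReal_le_of_le_ofReal (by positivity) ?_
  rw [lintegral_add_measure, lintegral_map hdist hf, lintegral_map hdist hg,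
    ENNReal.ofReal_add hη (by positivity)]
  refine add_le_add ?_ ?_
  · calc _ ≤ ∫⁻ _, ENNReal.ofReal η ∂(μ.withDensity fun y => t (s y)) :=
          lintegral_mono fun y => ENNReal.ofReal_le_ofReal (hs y)
      _ = ENNReal.ofReal η * ∫⁻ y, t (s y) ∂μ := by simp
      _ ≤ ENNReal.ofReal η * 1 := by gcongr
      _ = _ := mul_one _
  · calc _ ≤ ∫⁻ _, ENNReal.ofReal D ∂(μ.withDensity fun y => 1 - t (s y)) :=
          lintegral_mono fun y => ENNReal.ofReal_le_ofReal
            (Metric.dist_le_diam_of_mem (Bornology.IsBounded.all _) (mem_univ _) (mem_univ _))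
      _ = ENNReal.ofReal D * (1 - ∑ p ∈ s.range, a p) := by simp [hcompl]
      _ ≤ ENNReal.ofReal D * ENNReal.ofReal κ := by gcongr
      _ = _ := (ENNReal.ofReal_mul hD).symm

/-- A map on bounded functions to `ℕ` that only sees values on a finite set has finite image. -/
lemma finite_image_bounded_nat {α β : Type*} (T : Finset α) (m : ℕ) (G : (α → ℕ) → β)
    (hG : ∀ R R', (∀ p ∈ T, R p = R' p) → G R = G R') :
    (G '' {R | ∀ p, R p ≤ m}).Finite := by
  classical
  refine (finite_range fun r : T → Fin (m + 1) =>
    G fun p => if h : p ∈ T then (r ⟨p, h⟩ : ℕ) else 0).subset ?_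
  rintro _ ⟨R, hR, rfl⟩
  exact ⟨fun p => ⟨R p, Nat.lt_succ_of_le (hR p)⟩, hG _ _ fun p hp => by simp [hp]⟩

/-- Rounding an element of `[0, 1]` down to a multiple of `1 / m`. -/
lemma exists_nat_div_approx {w : ENNReal} (hw : w ≤ 1) {m : ℕ} (hm : (0 : ℝ) < m) :
    ∃ R : ℕ, R ≤ m ∧ (R : ENNReal) / m ≤ w ∧ w ≤ (R : ENNReal) / m + ENNReal.ofReal (1 / m) := by
  have hwtop : w ≠ ⊤ := ne_top_of_le_ne_top ENNReal.one_ne_top hw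
  have hdiv : ∀ R : ℕ, (R : ENNReal) / m = ENNReal.ofReal ((R : ℝ) / m) := fun R => by
    rw [ENNReal.ofReal_div_of_pos hm]; simp
  refine ⟨⌊(m : ℝ) * w.toReal⌋₊, Nat.floor_le_of_le ?_, ?_, ?_⟩
  · have : w.toReal ≤ 1 := ENNReal.toReal_le_of_le_ofReal zero_le_one (by simpa using hw)
    nlinarith
  · rw [hdiv]
    refine ENNReal.ofReal_le_of_le_toReal ?_
    rw [div_le_iff₀ hm, mul_comm w.toReal]
    exact Nat.floor_le (by positivity)
  · rw [hdiv, ← ENNReal.ofReal_add (by positivity) (by positivity),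
      ENNReal.le_ofReal_iff_toReal_le hwtop (by positivity), ← add_div, le_div_iff₀ hm,
      mul_comm w.toReal]
    exact (Nat.lt_floor_add_one _).le

/-- Probability measures on a compact metric space are totally bounded for the Wasserstein
distance. -/
lemma exists_finite_wassersteinDist_net [CompactSpace M] [BorelSpace M] [Nonempty M]
    {δ : ℝ} (hδ : 0 < δ) : ∃ S : Set (Measure M), S.Finite ∧
      (∀ ν ∈ S, IsProbabilityMeasure ν) ∧
      ∀ μ : Measure M, IsProbabilityMeasure μ → ∃ ν ∈ S, wassersteinDist μ ν ≤ δ := by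
  classical
  obtain ⟨s, hs⟩ := exists_simpleFunc_dist_le (M := M) (half_pos hδ)
  let p₀ : M := Classical.arbitrary M
  set D := Metric.diam (univ : Set M)
  have hD : 0 ≤ D := Metric.diam_nonneg
  obtain ⟨m, hm⟩ := exists_nat_gt (D * s.range.card / (δ / 2))
  have hm0 : (0 : ℝ) < m := lt_of_le_of_lt (by positivity) hm
  let G : (M → ENNReal) → Measure M := fun a =>
    ∑ p ∈ s.range, a p • Measure.dirac p + (1 - ∑ p ∈ s.range, a p) • Measure.dirac p₀
  have hG : ∀ a b : M → ENNReal, (∀ p ∈ s.range, a p = b p) → G a = G b := fun a b h => by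
    simp only [G]
    rw [Finset.sum_congr rfl h, Finset.sum_congr rfl fun p hp => by rw [h p hp]]
  refine ⟨_, (finite_image_bounded_nat s.range m (fun R => G fun p => (R p : ENNReal) / m)
    fun R R' h => hG _ _ fun p hp => by rw [h p hp]).inter_of_left {ν | IsProbabilityMeasure ν},
    fun ν hν => hν.2, fun μ hμ => ?_⟩
  choose R hRm haw hwa using fun p =>
    exists_nat_div_approx (prob_le_one (μ := μ) (s := s ⁻¹' {p})) hm0
  let a : M → ENNReal := fun p => (R p : ENNReal) / m
  have hwsum : ∑ p ∈ s.range, μ (s ⁻¹' {p}) = 1 := by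
    have h := SimpleFunc.map_lintegral (μ := μ) (fun _ => 1) s
    rw [← SimpleFunc.lintegral_eq_lintegral] at h
    simpa using h.symm
  have hrest : 1 - ∑ p ∈ s.range, a p ≤ ENNReal.ofReal (s.range.card / m) := by
    rw [tsub_le_iff_left, ← hwsum]
    calc ∑ p ∈ s.range, μ (s ⁻¹' {p}) ≤ ∑ p ∈ s.range, (a p + ENNReal.ofReal (1 / m)) :=
          Finset.sum_le_sum fun p _ => hwa p
      _ = ∑ p ∈ s.range, a p + ENNReal.ofReal (s.range.card / m) := by
          rw [Finset.sum_add_distrib, Finset.sum_const, ← ENNReal.ofReal_nsmul, nsmul_eq_mul,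
            mul_one_div]
  obtain ⟨hprob, hdist⟩ := wassersteinDist_rounding_le μ s (half_pos hδ).le hs p₀
    (fun p => a p / μ (s ⁻¹' {p})) (fun p => ENNReal.div_le_of_le_mul (by simpa using haw p)) a
    (fun p => ENNReal.div_mul_cancel' (fun h => le_antisymm (h ▸ haw p) zero_le)
      (fun h => absurd h (measure_ne_top _ _))) (by positivity) hrest
  refine ⟨G a, ⟨⟨R, hRm, rfl⟩, hprob⟩, hdist.trans ?_⟩
  have : D * (s.range.card / m) ≤ δ / 2 := by
    rw [div_lt_iff₀ (by positivity)] at hm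
    rw [← mul_div_assoc, div_le_iff₀ hm0]
    linarith
  linarith

lemma isBoundedUnder_iInf_wassersteinDist [CompactSpace M] (f : M → M) (x : M) {N : ℕ}
    (hN : 0 < N) (μs : Fin N → Measure M) (hμs : ∀ j, IsProbabilityMeasure (μs j)) :
    IsBoundedUnder (· ≤ ·) atTop
      fun n : ℕ => ⨅ j, wassersteinDist (empiricalMeasure f x n) (μs j) := by
  refine isBoundedUnder_of_eventually_le (a := Metric.diam (univ : Set M)) ?_
  filter_upwards [eventually_ne_atTop 0] with n hn
  have := isProbabilityMeasure_empiricalMeasure f x hn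
  exact (ciInf_le (finite_range _).bddBelow ⟨0, hN⟩).trans (wassersteinDist_le_diam _ _)

lemma limsup_iInf_wassersteinDist_le (f : M → M) (x : M) {N : ℕ} (μs : Fin N → Measure M)
    {a : ℝ} (h : ∀ᶠ n : ℕ in atTop, ⨅ j, wassersteinDist (empiricalMeasure f x n) (μs j) ≤ a) :
    limsup (fun n : ℕ => ⨅ j, wassersteinDist (empiricalMeasure f x n) (μs j)) atTop ≤ a :=
  limsup_le_of_le (isCoboundedUnder_le_of_le atTop (x := 0) fun _ =>
    Real.iInf_nonneg fun _ => wassersteinDist_nonneg _ _) h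

/-- The pointwise emergence at a positive scale is a minimum over a nonempty set. -/
lemma nonempty_limsup_wassersteinDist_le [CompactSpace M] [BorelSpace M] (f : M → M) (x : M)
    {δ : ℝ} (hδ : 0 < δ) :
    { N : ℕ | 0 < N ∧ ∃ μs : Fin N → Measure M, (∀ j, IsProbabilityMeasure (μs j)) ∧
      limsup (fun n : ℕ => ⨅ j, wassersteinDist (empiricalMeasure f x n) (μs j))
        atTop ≤ δ }.Nonempty := by
  have : Nonempty M := ⟨x⟩
  obtain ⟨S, hfin, hprob, hnet⟩ := exists_finite_wassersteinDist_net (M := M) hδ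
  have := hfin.fintype
  let e := Fintype.equivFin S
  obtain ⟨ν, hν, -⟩ := hnet (Measure.dirac x) inferInstance
  refine ⟨Fintype.card S, Fintype.card_pos_iff.2 ⟨⟨ν, hν⟩⟩, fun j => e.symm j,
    fun j => hprob _ (e.symm j).2, limsup_iInf_wassersteinDist_le f x _ ?_⟩
  filter_upwards [eventually_ne_atTop 0] with n hn
  obtain ⟨ν, hν, hle⟩ := hnet _ (isProbabilityMeasure_empiricalMeasure f x hn)
  refine (ciInf_le (finite_range _).bddBelow (e ⟨ν, hν⟩)).trans ?_
  simpa using hle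

end Wasserstein

/-- Let `X`, `Y` be compact metric spaces, `σ : X → X`, `F : Y → Y`
continuous, and `π : X → Y` a homeomorphism with `F ∘ π = π ∘ σ`. Suppose `c > 0`, `K > 0`
are such that `d_W(π_*μ, π_*ν) ≥ c · (d_W(μ,ν))^K` for all Borel probability measures
`μ, ν` on `X`. Then for every `x ∈ X` and `ε > 0`,
`ℰ_{σ,x}(ε) ≤ ℰ_{F,π(x)}(c · ε^K)`. -/
theorem pointwiseEmergence_le_of_wasserstein_bound
    {X Y : Type*} [MetricSpace X] [CompactSpace X] [MeasurableSpace X] [BorelSpace X]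
    [MetricSpace Y] [CompactSpace Y] [MeasurableSpace Y] [BorelSpace Y]
    (σ : X → X) (hσ : Continuous σ) (F : Y → Y) (hF : Continuous F)
    (π : X ≃ₜ Y) (hconj : ∀ a, F (π a) = π (σ a))
    (c K : ℝ) (hc : 0 < c) (hK : 0 < K)
    (hW : ∀ μ ν : Measure X, IsProbabilityMeasure μ → IsProbabilityMeasure ν →
      c * wassersteinDist μ ν ^ K ≤ wassersteinDist (μ.map π) (ν.map π))
    (x : X) (ε : ℝ) (hε : 0 < ε) :
    pointwiseEmergence σ x ε ≤ pointwiseEmergence F (π x) (c * ε ^ K) := by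
  have hsemi : Function.Semiconj π σ F := fun a => (hconj a).symm
  refine le_csInf (nonempty_limsup_wassersteinDist_le F (π x) (by positivity)) ?_
  rintro N ⟨hN, νs, hνs, hlim⟩
  have hsymm : Measurable π.symm := π.symm.continuous.measurable
  have hμs : ∀ j, IsProbabilityMeasure ((νs j).map π.symm) := fun j =>
    have := hνs j
    Measure.isProbabilityMeasure_map hsymm.aemeasurable
  have hmap : ∀ j, ((νs j).map π.symm).map π = νs j := fun j => by
    rw [Measure.map_map π.continuous.measurable hsymm, π.self_comp_symm, Measure.map_id]
  have : Nonempty (Fin N) := ⟨⟨0, hN⟩⟩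
  refine Nat.sInf_le ⟨hN, fun j => (νs j).map π.symm, hμs, le_of_forall_gt_imp_ge_of_dense ?_⟩
  intro ε' hε'
  have hlt : c * ε ^ K < c * ε' ^ K :=
    mul_lt_mul_of_pos_left (Real.rpow_lt_rpow hε.le hε' hK) hc
  refine limsup_iInf_wassersteinDist_le σ x _ ?_
  filter_upwards [eventually_ne_atTop 0, eventually_lt_of_limsup_lt (hlim.trans_lt hlt)
    (isBoundedUnder_iInf_wassersteinDist F (π x) hN νs hνs)] with n hn hnlt
  obtain ⟨j, hj⟩ := exists_eq_ciInf_of_finite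
    (f := fun j => wassersteinDist (empiricalMeasure F (π x) n) (νs j))
  refine (ciInf_le (finite_range _).bddBelow j).trans ?_
  have h := hW (empiricalMeasure σ x n) ((νs j).map π.symm)
    (isProbabilityMeasure_empiricalMeasure σ x hn) (hμs j)
  rw [hmap, empiricalMeasure_map π.continuous.measurable hsemi] at h
  refine ((Real.rpow_lt_rpow_iff (wassersteinDist_nonneg _ _) (hε.trans hε').le hK).1
    (lt_of_mul_lt_mul_left (h.trans_lt ?_) hc.le)).le
  rw [← hj] at hnlt
  exact hnlt
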